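/- Suppose λ ∈ O_S^* is a non-constant S-unit and S contains every point of C̃ where λ² = 4. If u and w are S-units each satisfying the equation (x′/x)²·(4 − λ²) + λ²·(λ′/λ)² = 0 (with x = u and x = w respectively), then u′/u = ±w′/w, and consequently either u/w ∈ κ^* or u·w ∈ κ^*; in particular any S-unit satisfying this equation is determined up to a multiplicative constant in κ^* and up to inversion. -/

import Mathlib

open scoped BigOperators Polynomial

/-- Abstract model of a smooth complete algebraic curve over an algebraically
closed field `κ` of characteristic zero, recorded through its function field
`K`, its set of closed points `Pt`, the normalized discrete valuation of `K`
attached to each point (trivial on the constants), the subfield `const ≅ κ` of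
constant functions, and the genus. -/
structure AbstractCurve where
  /-- the closed points of the curve -/
  Pt : Type
  /-- the function field `κ(C̃)` -/
  K : Type
  fieldK : Field K
  /-- the normalized discrete valuation attached to a point (order of
  vanishing: poles have negative valuation) -/
  val : Pt → K → ℤ
  /-- the subfield of constant functions, a copy of the algebraically closed
  ground field `κ` -/
  const : Subfield K
  /-- the genus of the curve -/
  genus : ℕ

attribute [instance] AbstractCurve.fieldK

namespace AbstractCurve

variable (C : AbstractCurve)

/-- Height of a rational function: `H(a) = Σ_v max{0, v(a)}`. -/
noncomputable def height (a : C.K) : ℤ := ∑ᶠ v : C.Pt, max 0 (C.val v a)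

/-- The ring `O_W` of `W`-integers: rational functions with all poles in `W`. -/
def integers (W : Finset C.Pt) : Set C.K := {a | ∀ v, v ∉ W → 0 ≤ C.val v a}

/-- The group `O_W^*` of `W`-units: rational functions with all zeros and
poles in `W`. -/
def sunits (W : Finset C.Pt) : Set C.K := {a | a ≠ 0 ∧ ∀ v, v ∉ W → C.val v a = 0}

/-- Euler characteristic of the affine curve `C̃ ∖ W`:
`χ_W(C̃) = 2g(C̃) − 2 + #W`. -/
def chi (W : Finset C.Pt) : ℤ := 2 * (C.genus : ℤ) - 2 + W.card

end AbstractCurve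

/-- if `λ ∈ O_S^*` is a non-constant `S`-unit, `S` contains all
points where `λ² = 4`, and the `S`-units `u, w` both satisfy
`(x′/x)²(4 − λ²) + λ²(λ′/λ)² = 0`, then `u′/u = ±w′/w`, and consequently
`u/w ∈ κ^*` or `u·w ∈ κ^*`: an `S`-unit satisfying the equation is determined
up to a multiplicative constant and up to inversion. -/
theorem log_derivative_equation_rigidity
    (C : AbstractCurve) (S : Finset C.Pt) (lam : C.K)
    (der : C.K → C.K)
    (hder_add : ∀ a b : C.K, der (a + b) = der a + der b)
    (hder_mul : ∀ a b : C.K, der (a * b) = a * der b + der a * b)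
    (hder_const : ∀ c ∈ C.const, der c = 0)
    (hker : ∀ a : C.K, der a = 0 → a ∈ C.const)
    (hlam_unit : lam ∈ C.sunits S) (hlam_nc : lam ∉ C.const)
    (hS4 : ∀ v : C.Pt, 0 < C.val v (lam ^ 2 - 4) → v ∈ S)
    (u w : C.K) (hu : u ∈ C.sunits S) (hw : w ∈ C.sunits S)
    (hueq : (der u / u) ^ 2 * (4 - lam ^ 2) + lam ^ 2 * (der lam / lam) ^ 2 = 0)
    (hweq : (der w / w) ^ 2 * (4 - lam ^ 2) + lam ^ 2 * (der lam / lam) ^ 2 = 0) :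
    (der u / u = der w / w ∨ der u / u = -(der w / w)) ∧
    ((∃ c ∈ C.const, c ≠ 0 ∧ u = c * w) ∨ (∃ c ∈ C.const, c ≠ 0 ∧ u * w = c)) := by
  have hlam2 : 4 - lam ^ 2 ≠ 0 := by
    intro h
    have h2 : (lam - 2) * (lam + 2) = 0 := by linear_combination -h
    have two_mem : (2 : C.K) ∈ C.const := ofNat_mem C.const 2
    rcases mul_eq_zero.mp h2 with h | h
    · exact hlam_nc (by rw [sub_eq_zero.mp h]; exact two_mem)
    · exact hlam_nc (by rw [eq_neg_of_add_eq_zero_left h]; exact neg_mem two_mem)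
  have hu0 : u ≠ 0 := hu.1
  have hw0 : w ≠ 0 := hw.1
  have hsq : (der u / u) ^ 2 = (der w / w) ^ 2 :=
    mul_right_cancel₀ hlam2 (by linear_combination hueq - hweq)
  have hpm := sq_eq_sq_iff_eq_or_eq_neg.mp hsq
  refine ⟨hpm, hpm.imp (fun h => ?_) (fun h => ?_)⟩
  · have huw : w * (u / w) = u := mul_div_cancel₀ u hw0
    refine ⟨u / w, hker _ ?_, div_ne_zero hu0 hw0, by rw [mul_comm, huw]⟩
    have hd := hder_mul w (u / w)
    rw [huw] at hd
    have hdu : der u = der w * (u / w) := by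
      field_simp at h ⊢
      linear_combination h
    exact (mul_eq_zero.mp (by linear_combination hdu - hd : w * der (u / w) = 0)).resolve_left hw0
  · refine ⟨u * w, hker _ ?_, mul_ne_zero hu0 hw0, rfl⟩
    rw [hder_mul]
    field_simp at h
    linear_combination h
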